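/- Let (X,d) be a compact metric space, f : X → X continuous, ψ ∈ C(X,ℝ) with ψ > 0, Φ = (φ₁,…,φ_d) ∈ C(X,ℝ)^d, and F : ℝ^d → ℝ continuous. For T > 0 and ε > 0 let P^F_{ψ,T}(f,Φ,ε) = sup{Σ_{n∈S_T} Σ_{x∈E_n} exp(n F(S_nΦ(x)/n)) : E_n an (n,ε)-separated set of X_n for each n ∈ S_T}. Then the nonlinear induced topological pressure satisfies P^F_ψ(Φ) = lim_{ε→0} limsup_{T→∞} (1/T) log P^F_{ψ,T}(f,Φ,ε). -/

import Mathlib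

open Filter Set Topology MeasureTheory ENNReal

variable {X : Type*}

/-- Birkhoff sum `S_n φ = ∑_{i<n} φ ∘ f^i`. -/
def birkhoff (f : X → X) (φ : X → ℝ) (n : ℕ) (x : X) : ℝ :=
  ∑ i ∈ Finset.range n, φ (f^[i] x)

section Metric
variable [MetricSpace X]

/-- `F` is an `(n,ε)`-spanning set of `Z`: every `y ∈ Z` is within Bowen distance
`d_n ≤ ε` of some point of `F`. -/
def IsSpanningSetOf (f : X → X) (n : ℕ) (ε : ℝ) (Z : Set X) (F : Finset X) : Prop :=
  ∀ y ∈ Z, ∃ x ∈ F, ∀ i < n, dist (f^[i] x) (f^[i] y) ≤ ε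

/-- `E` is an `(n,ε)`-separated set of `Z`: `E ⊆ Z` and distinct points of `E` are at
Bowen distance `d_n > ε`. -/
def IsSeparatedSetOf (f : X → X) (n : ℕ) (ε : ℝ) (Z : Set X) (E : Finset X) : Prop :=
  (E : Set X) ⊆ Z ∧ ∀ x ∈ E, ∀ y ∈ E, x ≠ y → ∃ i < n, ε < dist (f^[i] x) (f^[i] y)

/-- `S_T = {n : ℕ | ∃ x, S_nψ(x) ≤ T < S_{n+1}ψ(x)}`. -/
def inducedST (f : X → X) (ψ : X → ℝ) (T : ℝ) : Set ℕ :=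
  {n | ∃ x : X, birkhoff f ψ n x ≤ T ∧ T < birkhoff f ψ (n + 1) x}

/-- `X_n = {x | S_nψ(x) ≤ T < S_{n+1}ψ(x)}`. -/
def inducedXn (f : X → X) (ψ : X → ℝ) (T : ℝ) (n : ℕ) : Set X :=
  {x | birkhoff f ψ n x ≤ T ∧ T < birkhoff f ψ (n + 1) x}

/-- `Q_{ψ,T}(f,φ,ε)`: infimum over families of `(n,ε)`-spanning sets of the `X_n`, `n ∈ S_T`,
of `∑_{n ∈ S_T} ∑_{x ∈ F_n} e^{S_nφ(x)}`. -/
noncomputable def inducedQ (f : X → X) (ψ φ : X → ℝ) (T ε : ℝ) : ℝ≥0∞ :=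
  ⨅ (F : ℕ → Finset X) (_ : ∀ n ∈ inducedST f ψ T,
      IsSpanningSetOf f n ε (inducedXn f ψ T n) (F n)),
    ∑' n : inducedST f ψ T, ∑ x ∈ F n, ENNReal.ofReal (Real.exp (birkhoff f φ n x))

/-- `P_{ψ,T}(f,φ,ε)`: supremum over families of `(n,ε)`-separated sets of the `X_n`, `n ∈ S_T`,
of `∑_{n ∈ S_T} ∑_{x ∈ E_n} e^{S_nφ(x)}`. -/
noncomputable def inducedPsep (f : X → X) (ψ φ : X → ℝ) (T ε : ℝ) : ℝ≥0∞ :=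
  ⨆ (E : ℕ → Finset X) (_ : ∀ n ∈ inducedST f ψ T,
      IsSeparatedSetOf f n ε (inducedXn f ψ T n) (E n)),
    ∑' n : inducedST f ψ T, ∑ x ∈ E n, ENNReal.ofReal (Real.exp (birkhoff f φ n x))

/-- The ψ-induced topological pressure
`P_ψ(φ) = lim_{ε→0⁺} limsup_{T→∞} (1/T) log Q_{ψ,T}(f,φ,ε)`, the limit as `ε → 0⁺`
being realized as a `limsup` along `𝓝[>] 0` (since `ε ↦ limsup_T …` is monotone,
this coincides with the limit). -/
noncomputable def inducedPressure (f : X → X) (ψ φ : X → ℝ) : EReal :=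
  limsup (fun ε : ℝ =>
    limsup (fun T : ℝ => ENNReal.log (inducedQ f ψ φ T ε) * ((T⁻¹ : ℝ) : EReal)) atTop)
    (𝓝[>] (0 : ℝ))

/-- Topological entropy `h_top(f) = P_ψ(0)` with `ψ ≡ 1`. -/
noncomputable def topEntropy (f : X → X) : EReal :=
  inducedPressure f (fun _ => 1) (fun _ => 0)

end Metric
section NL
variable [MetricSpace X]

/-- The `d`-dimensional Birkhoff sum `S_nΦ` of `Φ ∈ C(X,ℝ)^d`. -/
def birkhoffVec (f : X → X) {d : ℕ} (Φ : X → Fin d → ℝ) (n : ℕ) (x : X) : Fin d → ℝ :=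
  fun i => birkhoff f (fun y => Φ y i) n x

/-- The nonlinear weight `exp(n F(S_nΦ(x)/n))`. -/
noncomputable def nlWeight (f : X → X) {d : ℕ} (F : (Fin d → ℝ) → ℝ) (Φ : X → Fin d → ℝ)
    (n : ℕ) (x : X) : ℝ≥0∞ :=
  ENNReal.ofReal (Real.exp (n * F (fun i => birkhoffVec f Φ n x i / n)))

/-- `Q^F_{ψ,T}(f,Φ,ε)`: infimum over families of `(n,ε)`-spanning sets of the `X_n`,
`n ∈ S_T`, of `∑_{n ∈ S_T} ∑_{x ∈ F_n} exp(n F(S_nΦ(x)/n))`. -/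
noncomputable def nlInducedQ (f : X → X) {d : ℕ} (ψ : X → ℝ) (F : (Fin d → ℝ) → ℝ)
    (Φ : X → Fin d → ℝ) (T ε : ℝ) : ℝ≥0∞ :=
  ⨅ (C : ℕ → Finset X) (_ : ∀ n ∈ inducedST f ψ T,
      IsSpanningSetOf f n ε (inducedXn f ψ T n) (C n)),
    ∑' n : inducedST f ψ T, ∑ x ∈ C n, nlWeight f F Φ n x

/-- The nonlinear ψ-induced topological pressure
`P^F_ψ(Φ) = lim_{ε→0⁺} limsup_{T→∞} (1/T) log Q^F_{ψ,T}(f,Φ,ε)` (limit as `ε → 0⁺`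
realized as a `limsup` along `𝓝[>] 0`). -/
noncomputable def nlInducedPressure (f : X → X) {d : ℕ} (ψ : X → ℝ) (F : (Fin d → ℝ) → ℝ)
    (Φ : X → Fin d → ℝ) : EReal :=
  limsup (fun ε : ℝ =>
    limsup (fun T : ℝ => ENNReal.log (nlInducedQ f ψ F Φ T ε) * ((T⁻¹ : ℝ) : EReal)) atTop)
    (𝓝[>] (0 : ℝ))

end NL

section Stmt17
variable [MetricSpace X]

/-- `P^F_{ψ,T}(f,Φ,ε)`: supremum over families of `(n,ε)`-separated sets of the `X_n`,
`n ∈ S_T`, of `∑_{n ∈ S_T} ∑_{x ∈ E_n} exp(n F(S_nΦ(x)/n))`. -/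
noncomputable def nlInducedPsep (f : X → X) {d : ℕ} (ψ : X → ℝ) (F : (Fin d → ℝ) → ℝ)
    (Φ : X → Fin d → ℝ) (T ε : ℝ) : ℝ≥0∞ :=
  ⨆ (E : ℕ → Finset X) (_ : ∀ n ∈ inducedST f ψ T,
      IsSeparatedSetOf f n ε (inducedXn f ψ T n) (E n)),
    ∑' n : inducedST f ψ T, ∑ x ∈ E n, nlWeight f F Φ n x

end Stmt17

section Bowen
variable [MetricSpace X] {f : X → X} {n : ℕ} {ε : ℝ} {Z : Set X}

/-- An `(n,ε)`-separated subset of `Z` injects into any `(n,ε/2)`-spanning set of `Z`, each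
point moving by at most `ε/2` in the Bowen distance. -/
lemma IsSeparatedSetOf.exists_injOn {E C : Finset X} (hE : IsSeparatedSetOf f n ε Z E)
    (hC : IsSpanningSetOf f n (ε / 2) Z C) :
    ∃ g : X → X, (∀ x ∈ E, g x ∈ C) ∧
      (∀ x ∈ E, ∀ i < n, dist (f^[i] (g x)) (f^[i] x) ≤ ε / 2) ∧ Set.InjOn g E := by
  have h : ∀ x, ∃ y, x ∈ E → y ∈ C ∧ ∀ i < n, dist (f^[i] y) (f^[i] x) ≤ ε / 2 := by
    intro x
    by_cases hx : x ∈ E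
    · obtain ⟨y, hy, hxy⟩ := hC x (hE.1 hx)
      exact ⟨y, fun _ => ⟨hy, hxy⟩⟩
    · exact ⟨x, fun h => absurd h hx⟩
  choose g hg using h
  refine ⟨g, fun x hx => (hg x hx).1, fun x hx => (hg x hx).2, fun x hx y hy hxy => ?_⟩
  by_contra hne
  obtain ⟨i, hi, hlt⟩ := hE.2 x hx y hy hne
  have h₁ := (hg x hx).2 i hi
  have h₂ := (hg y hy).2 i hi
  rw [← hxy] at h₂
  have h₃ := dist_triangle_left (f^[i] x) (f^[i] y) (f^[i] (g x))
  linarith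

/-- On a compact space, finite `(n,ε)`-spanning sets exist. -/
lemma exists_isSpanningSetOf_univ [CompactSpace X] (hf : Continuous f) (n : ℕ) (hε : 0 < ε) :
    ∃ C : Finset X, IsSpanningSetOf f n ε univ C := by
  let U : X → Set X := fun x => ⋂ i ∈ Finset.range n, {y | dist (f^[i] x) (f^[i] y) < ε}
  have hU : ∀ x ∈ (univ : Set X), U x ∈ 𝓝 x := by
    intro x _
    refine (Filter.biInter_finset_mem _).2 fun i _ => ?_
    refine (isOpen_lt (continuous_const.dist (hf.iterate i)) continuous_const).mem_nhds ?_
    simpa using hε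
  obtain ⟨C, -, hC⟩ := isCompact_univ.elim_nhds_subcover U hU
  refine ⟨C, fun y hy => ?_⟩
  obtain ⟨x, hx, hxy⟩ := mem_iUnion₂.1 (hC hy)
  refine ⟨x, hx, fun i hi => ?_⟩
  exact (mem_iInter₂.1 hxy i (Finset.mem_range.2 hi)).le

/-- On a compact space, every set has a separated subset that also spans it. -/
lemma exists_isSeparatedSetOf_isSpanningSetOf [CompactSpace X] (hf : Continuous f) (n : ℕ)
    (hε : 0 < ε) (Z : Set X) :
    ∃ E : Finset X, IsSeparatedSetOf f n ε Z E ∧ IsSpanningSetOf f n ε Z E := by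
  classical
  obtain ⟨C, hC⟩ := exists_isSpanningSetOf_univ hf n (half_pos hε)
  let S : Set ℕ := {k | ∃ E : Finset X, IsSeparatedSetOf f n ε Z E ∧ E.card = k}
  have hne : S.Nonempty := ⟨0, ∅, ⟨by simp, by simp⟩, rfl⟩
  have hbdd : BddAbove S := by
    refine ⟨C.card, ?_⟩
    rintro _ ⟨E, hE, rfl⟩
    obtain ⟨g, hgC, -, hinj⟩ := hE.exists_injOn (fun y _ => hC y (mem_univ y))
    exact Finset.card_le_card_of_injOn g hgC hinj
  obtain ⟨E, hE, hcard⟩ := Nat.sSup_mem hne hbdd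
  refine ⟨E, hE, fun y hy => ?_⟩
  by_contra! hfar
  have hyE : y ∉ E := by
    intro h
    obtain ⟨i, -, hi⟩ := hfar y h
    rw [dist_self] at hi
    exact hi.not_gt hε
  have hsep : IsSeparatedSetOf f n ε Z (insert y E) := by
    refine ⟨?_, fun a ha b hb hab => ?_⟩
    · rw [Finset.coe_insert]
      exact Set.insert_subset hy hE.1
    · rcases Finset.mem_insert.1 ha with rfl | ha' <;> rcases Finset.mem_insert.1 hb with rfl | hb'
      · exact absurd rfl hab
      · obtain ⟨i, hi, h⟩ := hfar b hb'
        exact ⟨i, hi, by rwa [dist_comm]⟩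
      · exact hfar a ha'
      · exact hE.2 a ha' b hb' hab
  have hle : (insert y E).card ≤ sSup S := le_csSup hbdd ⟨_, hsep, rfl⟩
  rw [Finset.card_insert_of_notMem hyE, hcard] at hle
  omega

end Bowen

section Birkhoff

lemma nsmul_le_birkhoff {f : X → X} {φ : X → ℝ} {m : ℝ} (h : ∀ x, m ≤ φ x) (n : ℕ) (x : X) :
    n * m ≤ birkhoff f φ n x := by
  simpa [birkhoff] using Finset.card_nsmul_le_sum (Finset.range n) (fun i => φ (f^[i] x)) m fun i _ => h _

lemma abs_birkhoff_div_le {f : X → X} {φ : X → ℝ} {K : ℝ} (hK : 0 ≤ K) (h : ∀ x, |φ x| ≤ K)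
    (n : ℕ) (x : X) : |birkhoff f φ n x / n| ≤ K := by
  rw [abs_div, Nat.abs_cast]
  refine div_le_of_le_mul₀ n.cast_nonneg hK ?_
  refine (Finset.abs_sum_le_sum_abs _ _).trans ?_
  simpa [mul_comm] using
    Finset.sum_le_card_nsmul (Finset.range n) (fun i => |φ (f^[i] x)|) K fun i _ => h _

lemma abs_birkhoff_div_sub_le {f : X → X} {φ : X → ℝ} {K : ℝ} (hK : 0 ≤ K) {n : ℕ} {x y : X}
    (h : ∀ i < n, |φ (f^[i] x) - φ (f^[i] y)| ≤ K) :
    |birkhoff f φ n x / n - birkhoff f φ n y / n| ≤ K := by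
  rw [← sub_div, abs_div, Nat.abs_cast]
  refine div_le_of_le_mul₀ n.cast_nonneg hK ?_
  rw [birkhoff, birkhoff, ← Finset.sum_sub_distrib]
  refine (Finset.abs_sum_le_sum_abs _ _).trans ?_
  simpa [mul_comm] using
    Finset.sum_le_card_nsmul (Finset.range n) (fun i => |φ (f^[i] x) - φ (f^[i] y)|) K
      fun i hi => h i (Finset.mem_range.1 hi)

end Birkhoff

section Weight
variable [MetricSpace X] [CompactSpace X] {f : X → X} {d : ℕ} {ψ : X → ℝ}
  {F : (Fin d → ℝ) → ℝ} {Φ : X → Fin d → ℝ}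

/-- Points that are close in the Bowen distance have comparable nonlinear weights. -/
lemma exists_nlWeight_le (f : X → X) (hΦ : Continuous Φ) (hF : Continuous F) {η : ℝ}
    (hη : 0 < η) :
    ∃ δ > 0, ∀ n x y, (∀ i < n, dist (f^[i] x) (f^[i] y) ≤ δ) →
      nlWeight f F Φ n x ≤ ENNReal.ofReal (Real.exp (n * η)) * nlWeight f F Φ n y := by
  obtain ⟨K, hK⟩ := (isCompact_range hΦ).isBounded.exists_norm_le
  have hK' : ∀ x i, |Φ x i| ≤ max K 0 := fun x i =>
    ((norm_le_pi_norm (Φ x) i).trans (hK _ (mem_range_self x))).trans (le_max_left _ _)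
  have hK0 : 0 ≤ max K 0 := le_max_right _ _
  have hFu := (isCompact_closedBall (0 : Fin d → ℝ) (max K 0)).uniformContinuousOn_of_continuous
    hF.continuousOn
  obtain ⟨ρ, hρ, hFρ⟩ := Metric.uniformContinuousOn_iff.1 hFu η hη
  obtain ⟨δ, hδ, hΦδ⟩ := Metric.uniformContinuous_iff.1
    (CompactSpace.uniformContinuous_of_continuous hΦ) (ρ / 2) (half_pos hρ)
  refine ⟨δ / 2, half_pos hδ, fun n x y hxy => ?_⟩
  have hball : ∀ z, (fun i => birkhoffVec f Φ n z i / n) ∈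
      Metric.closedBall (0 : Fin d → ℝ) (max K 0) := by
    intro z
    rw [mem_closedBall_zero_iff, pi_norm_le_iff_of_nonneg hK0]
    exact fun i => abs_birkhoff_div_le hK0 (fun w => hK' w i) n z
  have hdist : dist (fun i => birkhoffVec f Φ n x i / n) (fun i => birkhoffVec f Φ n y i / n)
      < ρ := by
    refine lt_of_le_of_lt ((dist_pi_le_iff (half_pos hρ).le).2 fun i => ?_) (half_lt_self hρ)
    refine abs_birkhoff_div_sub_le (half_pos hρ).le fun j hj => ?_
    refine (dist_le_pi_dist (Φ (f^[j] x)) (Φ (f^[j] y)) i).trans (hΦδ ?_).le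
    exact (hxy j hj).trans_lt (half_lt_self hδ)
  have hFle := (abs_lt.1 (hFρ _ (hball x) _ (hball y) hdist)).2
  rw [nlWeight, nlWeight, ← ENNReal.ofReal_mul (Real.exp_pos _).le, ← Real.exp_add, ← mul_add]
  refine ENNReal.ofReal_le_ofReal (Real.exp_le_exp.2 ?_)
  exact mul_le_mul_of_nonneg_left (by linarith) n.cast_nonneg

lemma nlInducedQ_le_nlInducedPsep (hf : Continuous f) (ψ : X → ℝ) (F : (Fin d → ℝ) → ℝ)
    (Φ : X → Fin d → ℝ) (T : ℝ) {ε : ℝ} (hε : 0 < ε) :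
    nlInducedQ f ψ F Φ T ε ≤ nlInducedPsep f ψ F Φ T ε := by
  choose E hsep hspan using fun n =>
    exists_isSeparatedSetOf_isSpanningSetOf hf n hε (inducedXn f ψ T n)
  exact (iInf₂_le E fun n _ => hspan n).trans
    (le_iSup₂_of_le E (fun n _ => hsep n) le_rfl)

lemma exists_nlInducedPsep_le (f : X → X) (hψ : Continuous ψ) (hψpos : ∀ x, 0 < ψ x)
    (hΦ : Continuous Φ) (hF : Continuous F) {c : ℝ} (hc : 0 < c) :
    ∃ δ > 0, ∀ ε ≤ δ, ∀ T, nlInducedPsep f ψ F Φ T ε ≤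
      ENNReal.ofReal (Real.exp (c * T)) * nlInducedQ f ψ F Φ T (ε / 2) := by
  obtain ⟨m, hm, hmψ⟩ : ∃ m > 0, ∀ x, m ≤ ψ x := by
    simpa using isCompact_univ.exists_forall_le' hψ.continuousOn fun x _ => hψpos x
  obtain ⟨δ, hδ, hw⟩ := exists_nlWeight_le f hΦ hF (mul_pos hc hm)
  refine ⟨2 * δ, by positivity, fun ε hε T => ?_⟩
  refine iSup₂_le fun E hE => ?_
  rw [nlInducedQ, ENNReal.mul_iInf_of_ne (by simp [Real.exp_pos]) ENNReal.ofReal_ne_top]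
  refine le_iInf fun C => ?_
  rw [ENNReal.mul_iInf_of_ne (by simp [Real.exp_pos]) ENNReal.ofReal_ne_top]
  refine le_iInf fun hC => ?_
  rw [← ENNReal.tsum_mul_left]
  refine ENNReal.tsum_le_tsum fun ⟨n, hn⟩ => ?_
  classical
  obtain ⟨g, hgC, hgd, hinj⟩ := (hE n hn).exists_injOn (hC n hn)
  obtain ⟨z, hz, -⟩ := hn
  have hnT : n * (c * m) ≤ c * T := by
    have := (nsmul_le_birkhoff hmψ n z).trans hz
    nlinarith
  calc ∑ x ∈ E n, nlWeight f F Φ n x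
      ≤ ∑ x ∈ E n, ENNReal.ofReal (Real.exp (c * T)) * nlWeight f F Φ n (g x) := by
        refine Finset.sum_le_sum fun x hx => ?_
        refine (hw n x (g x) fun i hi => ?_).trans ?_
        · rw [dist_comm]
          exact (hgd x hx i hi).trans (by linarith)
        · gcongr
    _ = ENNReal.ofReal (Real.exp (c * T)) * ∑ y ∈ (E n).image g, nlWeight f F Φ n y := by
        rw [← Finset.mul_sum, Finset.sum_image hinj]
    _ ≤ ENNReal.ofReal (Real.exp (c * T)) * ∑ y ∈ C n, nlWeight f F Φ n y := by
        gcongr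
        exact Finset.image_subset_iff.2 hgC

end Weight

section Growth

lemma EReal.limsup_coe_add_le {ι : Type*} (l : Filter ι) [l.NeBot] (c : ℝ) (u : ι → EReal) :
    limsup (fun i => (c : EReal) + u i) l ≤ c + limsup u l := by
  have h : limsup (fun _ : ι => (c : EReal)) l = c := limsup_const _
  simpa only [h, Pi.add_def] using EReal.limsup_add_le (f := l) (u := fun _ => (c : EReal)) (v := u)
    (by simp [h]) (by simp [h])

lemma EReal.le_of_forall_pos_le_coe_add {a b : EReal} (h : ∀ c : ℝ, 0 < c → a ≤ c + b) :
    a ≤ b := by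
  refine EReal.le_of_forall_lt_iff_le.1 fun z hz => ?_
  induction b with
  | bot => exact (h 1 one_pos).trans (by simp)
  | coe r =>
    refine (h (z - r) (_root_.sub_pos.2 (EReal.coe_lt_coe_iff.1 hz))).trans ?_
    rw [← EReal.coe_add, _root_.sub_add_cancel]
  | top => exact absurd hz not_top_lt

lemma limsup_comp_half_le (q : ℝ → EReal) :
    limsup (fun ε : ℝ => q (ε / 2)) (𝓝[>] 0) ≤ limsup q (𝓝[>] 0) := by
  have hhalf : Tendsto (fun ε : ℝ => ε / 2) (𝓝[>] 0) (𝓝[>] 0) := by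
    refine tendsto_nhdsWithin_iff.2 ⟨?_, ?_⟩
    · have : Tendsto (fun ε : ℝ => ε / 2) (𝓝 0) (𝓝 (0 / 2)) :=
        (continuous_id.div_const 2).tendsto 0
      rw [zero_div] at this
      exact this.mono_left nhdsWithin_le_nhds
    · filter_upwards [self_mem_nhdsWithin] with ε hε using half_pos (mem_Ioi.1 hε)
  exact limsup_le_limsup_of_le (u := q) hhalf

/-- An exponential factor of rate `c` shifts the exponential growth rate by at most `c`. -/
lemma limsup_log_mul_inv_le {u v : ℝ → ℝ≥0∞} {c : ℝ}
    (h : ∀ T, u T ≤ ENNReal.ofReal (Real.exp (c * T)) * v T) :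
    limsup (fun T : ℝ => ENNReal.log (u T) * ((T⁻¹ : ℝ) : EReal)) atTop ≤
      c + limsup (fun T : ℝ => ENNReal.log (v T) * ((T⁻¹ : ℝ) : EReal)) atTop := by
  refine (limsup_le_limsup ?_).trans (EReal.limsup_coe_add_le _ _ _)
  filter_upwards [eventually_gt_atTop 0] with T hT
  have hT' : (0 : EReal) ≤ ((T⁻¹ : ℝ) : EReal) := EReal.coe_nonneg.2 (inv_pos.2 hT).le
  refine (mul_le_mul_of_nonneg_right (ENNReal.log_monotone (h T)) hT').trans ?_
  rw [ENNReal.log_mul_add, ENNReal.log_ofReal_of_pos (Real.exp_pos _), Real.log_exp,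
    EReal.right_distrib_of_nonneg_of_ne_top hT' (EReal.coe_ne_top _), ← EReal.coe_mul,
    mul_inv_cancel_right₀ hT.ne']

end Growth

/-- The nonlinear induced topological pressure can equivalently be
computed with separated sets:
`P^F_ψ(Φ) = lim_{ε→0} limsup_{T→∞} (1/T) log P^F_{ψ,T}(f,Φ,ε)`. -/
theorem nlInducedPressure_eq_sep
    {X : Type*} [MetricSpace X] [CompactSpace X] {d : ℕ}
    (f : X → X) (hf : Continuous f)
    (ψ : X → ℝ) (hψ : Continuous ψ) (hψpos : ∀ x, 0 < ψ x)
    (Φ : X → Fin d → ℝ) (hΦ : Continuous Φ)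
    (F : (Fin d → ℝ) → ℝ) (hF : Continuous F) :
    nlInducedPressure f ψ F Φ =
      limsup (fun ε : ℝ =>
        limsup (fun T : ℝ =>
          ENNReal.log (nlInducedPsep f ψ F Φ T ε) * ((T⁻¹ : ℝ) : EReal)) atTop)
        (𝓝[>] (0 : ℝ)) := by
  apply le_antisymm
  · refine limsup_le_limsup ?_
    filter_upwards [self_mem_nhdsWithin] with ε hε
    refine limsup_le_limsup ?_
    filter_upwards [eventually_gt_atTop 0] with T hT
    exact mul_le_mul_of_nonneg_right
      (ENNReal.log_monotone (nlInducedQ_le_nlInducedPsep hf ψ F Φ T hε))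
      (EReal.coe_nonneg.2 (inv_pos.2 hT).le)
  · refine EReal.le_of_forall_pos_le_coe_add fun c hc => ?_
    obtain ⟨δ, hδ, h⟩ := exists_nlInducedPsep_le f hψ hψpos hΦ hF hc
    refine (limsup_le_limsup ?_).trans ((EReal.limsup_coe_add_le _ c _).trans
      (add_le_add_right (limsup_comp_half_le _) _))
    filter_upwards [Ioc_mem_nhdsGT hδ] with ε hε
    exact limsup_log_mul_inv_le (h ε hε.2)
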